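/- arXiv:2309.09871 — 11 statements merged into one kernel-verified Lean document; each statement's English description precedes it below -/
import Mathlib

section
/- For every H ∈ (0,1) and all s,t > 0 with s ≠ t, the quantity A(s,t) := (1/4)·(2·s^{2H} + 2·t^{2H} − |t−s|^{2H} − (t^{2H} − s^{2H})²/|t−s|^{2H}) is strictly positive and satisfies min(s^{2H}, t^{2H}) / A(s,t) ≤ 2^{2−2H} / (4 − 2^{2H}). -/
open Real

/-- The factor `A(s,t)` in the factorization `Θ_{s,t} = |t−s|^{2H}·A(s,t)`, where
`Θ_{s,t} = γ(s)·γ(t) − R(s,t)²` for the fBm covariance `R`. -/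
noncomputable def fbmA (H s t : ℝ) : ℝ :=
  (1/4) * (2 * s ^ (2*H) + 2 * t ^ (2*H) - |t - s| ^ (2*H)
    - (t ^ (2*H) - s ^ (2*H)) ^ 2 / |t - s| ^ (2*H))

theorem concaveOn_log_sinh : ConcaveOn ℝ (Set.Ioi 0) (fun u : ℝ => log (sinh u)) := by
  have hderiv : ∀ u ∈ Set.Ioi (0:ℝ),
      HasDerivAt (fun u : ℝ => log (sinh u)) (cosh u / sinh u) u := fun u hu =>
    (hasDerivAt_sinh u).log (sinh_pos_iff.2 hu).ne'
  refine AntitoneOn.concaveOn_of_deriv (convex_Ioi 0)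
    (fun u hu => (hderiv u hu).continuousAt.continuousWithinAt) ?_ ?_
  · rw [interior_Ioi]
    exact fun u hu => (hderiv u hu).differentiableAt.differentiableWithinAt
  · rw [interior_Ioi]
    intro a ha b hb hab
    rw [(hderiv a ha).deriv, (hderiv b hb).deriv,
      div_le_div_iff₀ (sinh_pos_iff.2 hb) (sinh_pos_iff.2 ha)]
    have h : 0 ≤ sinh (b - a) := sinh_nonneg_iff.2 (sub_nonneg.2 hab)
    rw [sinh_sub] at h
    linarith

theorem log_sinh_two_mul {u : ℝ} (hu : 0 < u) :
    log (sinh (2 * u)) = log (sinh u) + log (2 * cosh u) := by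
  rw [sinh_two_mul, ← log_mul (sinh_pos_iff.2 hu).ne' (by positivity)]
  ring_nf

theorem rpow_mul_sinh_eq_exp {u : ℝ} (hu : 0 < u) (β : ℝ) :
    (2 * cosh u) ^ β * sinh u = exp (log (sinh u) + β * log (2 * cosh u)) := by
  rw [exp_add, exp_log (sinh_pos_iff.2 hu), rpow_def_of_pos (by positivity),
    mul_comm β, mul_comm]

theorem rpow_mul_sinh_le_sinh_mul {α u : ℝ} (h1 : 1 ≤ α) (h2 : α ≤ 2) (hu : 0 < u) :
    (2 * cosh u) ^ (α - 1) * sinh u ≤ sinh (α * u) := by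
  have h := concaveOn_log_sinh.2 (Set.mem_Ioi.2 hu)
    (Set.mem_Ioi.2 (by positivity : 0 < 2 * u)) (sub_nonneg.2 h2) (sub_nonneg.2 h1) (by ring)
  simp only [smul_eq_mul] at h
  rw [log_sinh_two_mul hu, show (2 - α) * u + (α - 1) * (2 * u) = α * u by ring] at h
  have hpos : 0 < sinh (α * u) := sinh_pos_iff.2 (by positivity)
  rw [rpow_mul_sinh_eq_exp hu, ← exp_log hpos, exp_le_exp]
  linarith

theorem sinh_mul_le_rpow_mul_sinh {α u : ℝ} (h0 : 0 < α) (h1 : α ≤ 1) (hu : 0 < u) :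
    sinh (α * u) ≤ (2 * cosh u) ^ (α - 1) * sinh u := by
  have hα : 0 < 2 - α := by linarith
  have h := concaveOn_log_sinh.2 (Set.mem_Ioi.2 (by positivity : 0 < α * u))
    (Set.mem_Ioi.2 (by positivity : 0 < 2 * u)) (by positivity : 0 ≤ 1 / (2 - α))
    (div_nonneg (sub_nonneg.2 h1) hα.le : 0 ≤ (1 - α) / (2 - α)) (by field_simp; ring)
  simp only [smul_eq_mul] at h
  rw [log_sinh_two_mul hu,
    show 1 / (2 - α) * (α * u) + (1 - α) / (2 - α) * (2 * u) = u by field_simp; ring] at h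
  have h' := mul_le_mul_of_nonneg_left h hα.le
  rw [mul_add, ← mul_assoc, ← mul_assoc, mul_one_div_cancel hα.ne', mul_div_cancel₀ _ hα.ne'] at h'
  have hpos : 0 < sinh (α * u) := sinh_pos_iff.2 (by positivity)
  rw [rpow_mul_sinh_eq_exp hu, ← exp_log hpos, exp_le_exp]
  linarith

theorem hasDerivAt_rpow_cosh_sub (α u : ℝ) :
    HasDerivAt (fun u : ℝ => (2 * cosh u) ^ α - 2 * cosh (α * u))
      (2 * α * ((2 * cosh u) ^ (α - 1) * sinh u - sinh (α * u))) u := by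
  have h1 := ((hasDerivAt_cosh u).const_mul 2).rpow_const (p := α)
    (Or.inl (by positivity : 2 * cosh u ≠ 0))
  have h2 := (((hasDerivAt_id u).const_mul α).cosh).const_mul 2
  refine (h1.sub h2).congr_deriv ?_
  simp only [id]
  ring

theorem rpow_cosh_sub_le {α : ℝ} (h1 : 1 ≤ α) (h2 : α ≤ 2) (u : ℝ) :
    (2 * cosh u) ^ α - 2 * cosh (α * u) ≤ 2 ^ α - 2 := by
  have hanti : AntitoneOn (fun u : ℝ => (2 * cosh u) ^ α - 2 * cosh (α * u)) (Set.Ici 0) := by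
    refine antitoneOn_of_deriv_nonpos (convex_Ici 0)
      (fun u _ => (hasDerivAt_rpow_cosh_sub α u).continuousAt.continuousWithinAt)
      (fun u _ => (hasDerivAt_rpow_cosh_sub α u).differentiableAt.differentiableWithinAt) ?_
    intro u hu
    rw [interior_Ici] at hu
    rw [(hasDerivAt_rpow_cosh_sub α u).deriv]
    exact mul_nonpos_of_nonneg_of_nonpos (by positivity)
      (sub_nonpos.2 (rpow_mul_sinh_le_sinh_mul h1 h2 hu))
  have h := hanti Set.self_mem_Ici (Set.mem_Ici.2 (abs_nonneg u)) (abs_nonneg u)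
  rw [← cosh_abs u, ← cosh_abs (α * u), abs_mul, abs_of_pos (by positivity : 0 < α)]
  simpa using h

theorem le_rpow_cosh_sub {α : ℝ} (h0 : 0 < α) (h1 : α ≤ 1) (u : ℝ) :
    2 ^ α - 2 ≤ (2 * cosh u) ^ α - 2 * cosh (α * u) := by
  have hmono : MonotoneOn (fun u : ℝ => (2 * cosh u) ^ α - 2 * cosh (α * u)) (Set.Ici 0) := by
    refine monotoneOn_of_deriv_nonneg (convex_Ici 0)
      (fun u _ => (hasDerivAt_rpow_cosh_sub α u).continuousAt.continuousWithinAt)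
      (fun u _ => (hasDerivAt_rpow_cosh_sub α u).differentiableAt.differentiableWithinAt) ?_
    intro u hu
    rw [interior_Ici] at hu
    rw [(hasDerivAt_rpow_cosh_sub α u).deriv]
    exact mul_nonneg (by positivity) (sub_nonneg.2 (sinh_mul_le_rpow_mul_sinh h0 h1 hu))
  have h := hmono Set.self_mem_Ici (Set.mem_Ici.2 (abs_nonneg u)) (abs_nonneg u)
  rw [← cosh_abs u, ← cosh_abs (α * u), abs_mul, abs_of_pos h0]
  simpa using h

/-- The ratio `(x^α + y^α - (x+y)^α)² / (x^α y^α)` is largest at `x = y`. -/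
theorem sq_rpow_add_sub_le {α x y : ℝ} (h0 : 0 < α) (h2 : α ≤ 2) (hx : 0 < x) (hy : 0 < y) :
    (x ^ α + y ^ α - (x + y) ^ α) ^ 2 ≤ (2 - 2 ^ α) ^ 2 * (x ^ α * y ^ α) := by
  obtain ⟨v, u, rfl, rfl⟩ : ∃ v u : ℝ, x = exp v * exp u ∧ y = exp v * exp (-u) := by
    refine ⟨(log x + log y) / 2, (log x - log y) / 2, ?_, ?_⟩
    · rw [← exp_add, ← add_div, add_add_sub_cancel, add_self_div_two, exp_log hx]
    · rw [← exp_add, ← sub_eq_add_neg, ← sub_div, add_sub_sub_cancel, add_self_div_two, exp_log hy]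
  have hsum : exp v * exp u + exp v * exp (-u) = exp v * (2 * cosh u) := by
    rw [cosh_eq]; ring
  have hsuper : 1 ≤ α → (exp v * exp u) ^ α + (exp v * exp (-u)) ^ α
      ≤ (exp v * exp u + exp v * exp (-u)) ^ α :=
    fun h => Real.add_rpow_le_rpow_add hx.le hy.le h
  have hsub : α ≤ 1 → (exp v * exp u + exp v * exp (-u)) ^ α
      ≤ (exp v * exp u) ^ α + (exp v * exp (-u)) ^ α :=
    fun h => Real.rpow_add_le_add_rpow hx.le hy.le h0.le h
  have hE : 0 < exp v ^ α := by positivity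
  have hprod : exp u ^ α * exp (-u) ^ α = 1 := by
    rw [← mul_rpow (exp_pos _).le (exp_pos _).le, ← exp_add]; simp
  have hcosh : exp u ^ α + exp (-u) ^ α = 2 * cosh (α * u) := by
    rw [cosh_eq, ← exp_mul, ← exp_mul]; ring_nf
  rw [hsum] at hsuper hsub ⊢
  rw [mul_rpow (exp_pos _).le (exp_pos _).le, mul_rpow (exp_pos _).le (exp_pos _).le,
    mul_rpow (exp_pos _).le (by positivity), ← mul_add, hcosh] at hsuper hsub ⊢
  rw [mul_mul_mul_comm, hprod, mul_one, ← mul_sub, mul_pow, ← sq,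
    mul_comm ((2 - 2 ^ α) ^ 2)]
  refine mul_le_mul_of_nonneg_left (sq_le_sq.2 ?_) (by positivity)
  rcases le_total α 1 with h | h
  · have h3 := le_of_mul_le_mul_left (hsub h) hE
    rw [abs_of_nonneg (sub_nonneg.2 h3)]
    exact le_trans (by linarith [le_rpow_cosh_sub h0 h u]) (le_abs_self _)
  · have h3 := le_of_mul_le_mul_left (hsuper h) hE
    rw [abs_of_nonpos (sub_nonpos.2 h3)]
    exact le_trans (by linarith [rpow_cosh_sub_le h h2 u]) (neg_le_abs _)

theorem fbmA_comm (H s t : ℝ) : fbmA H s t = fbmA H t s := by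
  unfold fbmA
  rw [abs_sub_comm]
  ring

theorem rpow_mul_le_fbmA {H s t : ℝ} (hH : H ∈ Set.Ioo (0:ℝ) 1) (hs : 0 < s) (hst : s < t) :
    s ^ (2 * H) * ((2:ℝ) ^ (2 * H) * (4 - (2:ℝ) ^ (2 * H)) / 4) ≤ fbmA H s t := by
  have hd : 0 < t - s := sub_pos.2 hst
  have h := sq_rpow_add_sub_le (α := 2 * H) (by linarith [hH.1]) (by linarith [hH.2]) hs hd
  rw [add_sub_cancel] at h
  unfold fbmA
  rw [abs_of_pos hd]
  have hb : 0 < (t - s) ^ (2 * H) := by positivity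
  have key : (t ^ (2 * H) - s ^ (2 * H)) ^ 2 / (t - s) ^ (2 * H) ≤
      2 * s ^ (2 * H) + 2 * t ^ (2 * H) - (t - s) ^ (2 * H)
        - s ^ (2 * H) * ((2:ℝ) ^ (2 * H) * (4 - (2:ℝ) ^ (2 * H))) := by
    rw [div_le_iff₀ hb]
    linarith
  linarith

theorem fbmA_pos_and_bound (H : ℝ) (hH : H ∈ Set.Ioo (0:ℝ) 1)
    (s t : ℝ) (hs : 0 < s) (ht : 0 < t) (hst : s ≠ t) :
    0 < fbmA H s t ∧
      min (s ^ (2*H)) (t ^ (2*H)) / fbmA H s t ≤ (2:ℝ) ^ (2 - 2*H) / (4 - (2:ℝ) ^ (2*H)) := by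
  wlog h : s < t generalizing s t
  · rw [fbmA_comm, min_comm]
    exact this t s ht hs hst.symm (lt_of_le_of_ne (not_lt.1 h) hst.symm)
  have hle := rpow_mul_le_fbmA hH hs h
  have hC : (2:ℝ) ^ (2 * H) < 4 := by
    calc (2:ℝ) ^ (2 * H) < 2 ^ (2:ℝ) :=
          rpow_lt_rpow_of_exponent_lt one_lt_two (by linarith [hH.2])
      _ = 4 := by norm_num
  have hC' : 0 < 4 - (2:ℝ) ^ (2 * H) := sub_pos.2 hC
  have hpos : 0 < fbmA H s t := lt_of_lt_of_le (by positivity) hle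
  refine ⟨hpos, ?_⟩
  rw [min_eq_left (rpow_le_rpow hs.le h.le (by linarith [hH.1])), rpow_sub two_pos,
    div_le_div_iff₀ hpos hC', div_mul_eq_mul_div, le_div_iff₀ (by positivity)]
  norm_num
  linarith
end

section
/- For every H ∈ (0,1) there exists a constant C > 0, depending only on H, such that for all s,t > 0 with s ≠ t: 1/Θ_{s,t}² ≤ C / ( |t−s|^{4H} · min(s^{4H}, t^{4H}) ). -/
open Real

/-- Covariance of fractional Brownian motion with Hurst parameter `H`. -/
noncomputable def fbmR (H s t : ℝ) : ℝ := (t ^ (2*H) + s ^ (2*H) - |t - s| ^ (2*H)) / 2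

/-- `Θ_{s,t} = γ(s)·γ(t) − R(s,t)²` where `γ(s) = R(s,s) = s^{2H}`. -/
noncomputable def fbmTheta (H s t : ℝ) : ℝ := s ^ (2*H) * t ^ (2*H) - (fbmR H s t) ^ 2

theorem rpow_add_add_rpow_le {H s d : ℝ} (hH0 : 0 ≤ H) (hH1 : H ≤ 1) (hs : 0 < s) (hsd : s ≤ d) :
    s ^ H + (s + d) ^ H ≤ (2 * s) ^ H + d ^ H := by
  have hd : 0 < d := hs.trans_le hsd
  have hf := (Real.concaveOn_rpow hH0 hH1).2
  have hl : 0 ≤ (d - s) / d := div_nonneg (by linarith) hd.le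
  have hr : 0 ≤ s / d := by positivity
  have hlr : (d - s) / d + s / d = 1 := by field_simp; ring
  have hs_mem : s ∈ Set.Ici (0 : ℝ) := hs.le
  have hsd_mem : s + d ∈ Set.Ici (0 : ℝ) := by
    simp only [Set.mem_Ici]; linarith
  have h1 := hf hs_mem hsd_mem hl hr hlr
  have h2 := hf hs_mem hsd_mem hr hl (by linarith)
  simp only [smul_eq_mul] at h1 h2
  rw [show (d - s) / d * s + s / d * (s + d) = 2 * s by field_simp; ring] at h1
  rw [show s / d * s + (d - s) / d * (s + d) = d by field_simp; ring] at h2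
  have h3 : (d - s) / d = 1 - s / d := by linarith
  rw [h3] at h1 h2
  linarith

theorem two_sub_rpow_mul_le {H s d : ℝ} (hH0 : 0 ≤ H) (hH1 : H ≤ 1) (hs : 0 < s) (hsd : s ≤ d) :
    (2 - 2 ^ H) * s ^ H ≤ s ^ H + d ^ H - (s + d) ^ H := by
  have h := rpow_add_add_rpow_le hH0 hH1 hs hsd
  rw [Real.mul_rpow (by norm_num) hs.le] at h
  linarith

/-- Heron's factorization, bounded below when the largest side `b` is separated from `a + e`. -/
theorem heron_lower_bound {a b e c : ℝ} (ha : 0 < a) (hae : a ≤ e) (heb : e ≤ b)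
    (hc : 0 ≤ c) (h : c * a ≤ a + e - b) :
    c / 4 * (a ^ 2 * e ^ 2) ≤ a ^ 2 * b ^ 2 - ((b ^ 2 + a ^ 2 - e ^ 2) / 2) ^ 2 := by
  have he : 0 < e := ha.trans_le hae
  have h1 : e * a ≤ (a + b + e) * (a + b - e) :=
    mul_le_mul (by linarith) (by linarith) ha.le (by linarith)
  have h2 : e * (c * a) ≤ (b + e - a) * (a + e - b) :=
    mul_le_mul (by linarith) h (by positivity) (by linarith)
  have h3 := mul_le_mul h1 h2 (by positivity) ((by positivity : 0 ≤ e * a).trans h1)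
  linarith

theorem fbmTheta_lower_bound {H s t : ℝ} (hH0 : 0 < H) (hH1 : H < 1) (hs : 0 < s) (hst : s < t) :
    (2 - 2 ^ H) / 4 * (s ^ (2 * H) * (t - s) ^ (2 * H)) ≤ fbmTheta H s t := by
  have hd : 0 < t - s := sub_pos.2 hst
  have ht : 0 < t := hs.trans hst
  have hc : (0 : ℝ) ≤ 2 - 2 ^ H := by
    have := Real.rpow_le_rpow_of_exponent_le (x := 2) (by norm_num) hH1.le
    rw [Real.rpow_one] at this
    linarith
  have hsq : ∀ x : ℝ, 0 < x → x ^ (2 * H) = (x ^ H) ^ 2 := fun x hx => by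
    rw [mul_comm, Real.rpow_mul hx.le, Real.rpow_two]
  have ha : 0 < s ^ H := Real.rpow_pos_of_pos hs H
  have he : 0 < (t - s) ^ H := Real.rpow_pos_of_pos hd H
  have hab : s ^ H ≤ t ^ H := Real.rpow_le_rpow hs.le hst.le hH0.le
  have heb : (t - s) ^ H ≤ t ^ H := Real.rpow_le_rpow hd.le (by linarith) hH0.le
  unfold fbmTheta fbmR
  rw [abs_of_pos hd, hsq s hs, hsq t ht, hsq _ hd]
  rcases le_total s (t - s) with h | h
  · have h1 := two_sub_rpow_mul_le hH0.le hH1.le hs h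
    rw [add_sub_cancel] at h1
    exact heron_lower_bound ha (Real.rpow_le_rpow hs.le h hH0.le) heb hc h1
  · have h1 := two_sub_rpow_mul_le hH0.le hH1.le hd h
    rw [sub_add_cancel] at h1
    have h2 := heron_lower_bound he (Real.rpow_le_rpow hd.le h hH0.le) hab hc h1
    linarith

theorem fbmTheta_comm (H s t : ℝ) : fbmTheta H s t = fbmTheta H t s := by
  unfold fbmTheta fbmR
  rw [abs_sub_comm]
  ring

theorem theta_inv_sq_bound (H : ℝ) (hH : H ∈ Set.Ioo (0:ℝ) 1) :
    ∃ C > 0, ∀ s t : ℝ, 0 < s → 0 < t → s ≠ t →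
      1 / (fbmTheta H s t) ^ 2 ≤ C / (|t - s| ^ (4*H) * min (s ^ (4*H)) (t ^ (4*H))) := by
  obtain ⟨hH0, hH1⟩ := hH
  have hc : (0 : ℝ) < 2 - 2 ^ H := by
    have := Real.rpow_lt_rpow_of_exponent_lt (x := 2) (by norm_num) hH1
    rw [Real.rpow_one] at this
    linarith
  refine ⟨(4 / (2 - 2 ^ H)) ^ 2, by positivity, fun s t hs ht hne => ?_⟩
  wlog hst : s < t generalizing s t
  · have h := this t s ht hs hne.symm (lt_of_le_of_ne (not_lt.1 hst) hne.symm)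
    rwa [fbmTheta_comm, abs_sub_comm, min_comm]
  have hd : 0 < t - s := sub_pos.2 hst
  have hsq : ∀ x : ℝ, 0 < x → x ^ (4 * H) = (x ^ (2 * H)) ^ 2 := fun x hx => by
    rw [← Real.rpow_two, ← Real.rpow_mul hx.le]
    ring_nf
  rw [min_eq_left (Real.rpow_le_rpow hs.le hst.le (by linarith)), abs_of_pos hd, hsq s hs, hsq _ hd]
  have hp : 0 < s ^ (2 * H) := Real.rpow_pos_of_pos hs _
  have hq : 0 < (t - s) ^ (2 * H) := Real.rpow_pos_of_pos hd _
  have hb := fbmTheta_lower_bound hH0 hH1 hs hst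
  calc 1 / fbmTheta H s t ^ 2
      ≤ 1 / ((2 - 2 ^ H) / 4 * (s ^ (2 * H) * (t - s) ^ (2 * H))) ^ 2 := by gcongr
    _ = _ := by field_simp
end

section
/- Let 0 < H < 1/2 and a > 0. Define ℓ_a(x) := |a+x|^{2H} − |a−x|^{2H} for x ∈ ℝ. Then the supremum over x > 0 of |ℓ_a(x)|/x equals 2^{2H}·a^{2H−1}; in particular |ℓ_a(x)| ≤ 2^{2H}·a^{2H−1}·x for all x > 0, with equality at x = a. -/
open Real

/-- `ℓ_a(x) = |a+x|^{2H} − |a−x|^{2H}`. -/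
noncomputable def ellA (H a x : ℝ) : ℝ := |a + x| ^ (2*H) - |a - x| ^ (2*H)

/-- Bernoulli's inequality for exponents in `[-1, 0]`. -/
lemma one_sub_mul_sub_one_le_rpow_neg {y q : ℝ} (hy : 0 < y) (hq0 : 0 ≤ q) (hq1 : q ≤ 1) :
    1 - q * (y - 1) ≤ y ^ (-q) := by
  have h := rpow_one_add_le_one_add_mul_self (s := y - 1) (by linarith) hq0 hq1
  rw [add_sub_cancel] at h
  have hpos : 0 < y ^ q := rpow_pos_of_pos hy q
  rw [rpow_neg hy.le, ← one_div, le_div_iff₀ hpos]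
  rcases le_or_gt (1 - q * (y - 1)) 0 with hneg | hnn
  · nlinarith
  · nlinarith [mul_le_mul_of_nonneg_left h hnn.le, sq_nonneg (q * (y - 1))]

lemma one_le_one_sub_mul_rpow_add_rpow {s p : ℝ} (hs0 : 0 < s) (hs1 : s ≤ 1)
    (hp0 : 0 ≤ p) (hp1 : p ≤ 1) : 1 ≤ (1 - s) * (1 + s) ^ (p - 1) + s ^ p := by
  have h1 := one_sub_mul_sub_one_le_rpow_neg (y := 1 + s) (q := 1 - p)
    (by linarith) (by linarith) (by linarith)
  have h2 := one_sub_mul_sub_one_le_rpow_neg (y := s) (q := 1 - p)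
    hs0 (by linarith) (by linarith)
  rw [neg_sub] at h1 h2
  have h3 : s ^ p = s * s ^ (p - 1) := by
    rw [rpow_sub_one hs0.ne']
    field_simp
  rw [h3]
  nlinarith [mul_le_mul_of_nonneg_left h1 (sub_nonneg.2 hs1),
    mul_le_mul_of_nonneg_left h2 hs0.le]

lemma add_rpow_sub_sub_rpow_le {a x p : ℝ} (hx : 0 < x) (hxa : x < a)
    (hp0 : 0 ≤ p) (hp1 : p ≤ 1) :
    (a + x) ^ p - (a - x) ^ p ≤ (2 : ℝ) ^ p * a ^ (p - 1) * x := by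
  have ha : 0 < a := hx.trans hxa
  have hu : 0 < a + x := by linarith
  have hv : 0 < a - x := by linarith
  have h := one_le_one_sub_mul_rpow_add_rpow (s := (a - x) / (a + x)) (div_pos hv hu)
    ((div_le_one hu).2 (by linarith)) hp0 hp1
  have e1 : 1 - (a - x) / (a + x) = 2 * x / (a + x) := by field_simp; ring
  have e2 : 1 + (a - x) / (a + x) = 2 * a / (a + x) := by field_simp; ring
  rw [e1, e2, div_rpow hv.le hu.le, div_rpow (by positivity) hu.le,
    mul_rpow zero_le_two ha.le, rpow_sub_one two_ne_zero, rpow_sub_one hu.ne'] at h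
  have hup : 0 < (a + x) ^ p := rpow_pos_of_pos hu p
  have h' := mul_le_mul_of_nonneg_left h hup.le
  have e3 : (a + x) ^ p * (2 * x / (a + x) *
      ((2 : ℝ) ^ p / 2 * a ^ (p - 1) / ((a + x) ^ p / (a + x))) + (a - x) ^ p / (a + x) ^ p)
      = (2 : ℝ) ^ p * a ^ (p - 1) * x + (a - x) ^ p := by
    field_simp
  rw [e3] at h'
  linarith

lemma two_rpow_mul_rpow_sub_one_mul_self {a : ℝ} (ha : 0 < a) (p : ℝ) :
    (2 : ℝ) ^ p * a ^ (p - 1) * a = (2 * a) ^ p := by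
  rw [mul_rpow zero_le_two ha.le, rpow_sub_one ha.ne']
  field_simp

lemma abs_ellA_le {H a x : ℝ} (h0 : 0 < H) (h1 : H < 1/2) (ha : 0 < a) (hx : 0 < x) :
    |ellA H a x| ≤ (2:ℝ) ^ (2*H) * a ^ (2*H - 1) * x := by
  have hle : |a - x| ≤ |a + x| := by
    rw [abs_of_pos (add_pos ha hx), abs_le]
    constructor <;> linarith
  rw [ellA, abs_of_nonneg
    (sub_nonneg.2 (rpow_le_rpow (abs_nonneg _) hle (by linarith))), abs_of_pos (add_pos ha hx)]
  rcases lt_or_ge x a with hxa | hxa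
  · rw [abs_of_pos (sub_pos.2 hxa)]
    exact add_rpow_sub_sub_rpow_le hx hxa (by linarith) (by linarith)
  · rw [abs_of_nonpos (sub_nonpos.2 hxa), neg_sub]
    have h := rpow_add_le_add_rpow (p := 2 * H) (a := 2 * a) (b := x - a)
      (by linarith) (by linarith) (by linarith) (by linarith)
    rw [show 2 * a + (x - a) = a + x by ring, ← two_rpow_mul_rpow_sub_one_mul_self ha] at h
    have hc : 0 ≤ (2:ℝ) ^ (2*H) * a ^ (2*H - 1) := by positivity
    linarith [mul_le_mul_of_nonneg_left hxa hc]

lemma abs_ellA_self_div {H a : ℝ} (h0 : 0 < H) (ha : 0 < a) :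
    |ellA H a a| / a = (2:ℝ) ^ (2*H) * a ^ (2*H - 1) := by
  rw [div_eq_iff ha.ne', two_rpow_mul_rpow_sub_one_mul_self ha, ellA, sub_self, abs_zero,
    zero_rpow (by linarith), sub_zero, ← two_mul, abs_of_pos (by positivity : 0 < 2 * a),
    abs_of_nonneg (by positivity)]

theorem ellA_sup (H a : ℝ) (h0 : 0 < H) (h1 : H < 1/2) (ha : 0 < a) :
    IsGreatest ((fun x => |ellA H a x| / x) '' Set.Ioi 0) ((2:ℝ) ^ (2*H) * a ^ (2*H - 1)) ∧
      (∀ x > (0:ℝ), |ellA H a x| ≤ (2:ℝ) ^ (2*H) * a ^ (2*H - 1) * x) ∧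
      |ellA H a a| / a = (2:ℝ) ^ (2*H) * a ^ (2*H - 1) := by
  refine ⟨⟨⟨a, ha, abs_ellA_self_div h0 ha⟩, ?_⟩, fun x hx => abs_ellA_le h0 h1 ha hx,
    abs_ellA_self_div h0 ha⟩
  rintro _ ⟨x, hx, rfl⟩
  exact (div_le_iff₀ hx).2 (abs_ellA_le h0 h1 ha hx)
end

section
/- Let 0 < H < 1/2. For all real numbers 0 ≤ s ≤ t, it holds that |R(s,t) − s^{2H}| ≤ min( s^H·(t−s)^H, (t−s)^{2H}, s^{2H} ). -/
open Real

theorem phi_bound (H : ℝ) (h0 : 0 < H) (h1 : H < 1/2)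
    (s t : ℝ) (hs : 0 ≤ s) (hst : s ≤ t) :
    |fbmR H s t - s ^ (2*H)| ≤
      min (s ^ H * (t - s) ^ H) (min ((t - s) ^ (2*H)) (s ^ (2*H))) := by
  have hu : 0 ≤ t - s := sub_nonneg.mpr hst
  have hsub : t ^ (2*H) ≤ s ^ (2*H) + (t - s) ^ (2*H) := by
    have h := Real.rpow_add_le_add_rpow hs hu (by linarith : 0 ≤ 2*H) (by linarith)
    rwa [add_sub_cancel] at h
  have hst' : s ^ (2*H) ≤ t ^ (2*H) := Real.rpow_le_rpow hs hst (by linarith)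
  have hut : (t - s) ^ (2*H) ≤ t ^ (2*H) := Real.rpow_le_rpow hu (by linarith) (by linarith)
  have hsq : ∀ x : ℝ, 0 ≤ x → x ^ (2*H) = (x ^ H) ^ 2 := fun x hx => by
    rw [mul_comm, Real.rpow_mul hx, Real.rpow_two]
  have hx := Real.rpow_nonneg hs H
  have hy := Real.rpow_nonneg hu H
  rw [fbmR, abs_of_nonneg hu]
  rw [hsq s hs, hsq (t - s) hu] at *
  refine le_min ?_ (le_min ?_ ?_) <;> rw [abs_le] <;> constructor
  · rcases le_total (s ^ H) ((t - s) ^ H) with h | h <;> nlinarith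
  all_goals nlinarith
end

section
/- Let 0 < H < 1/2. There exists a constant C > 0, depending only on H, such that for every δ ∈ (0,1) and all s,t with 0 < s < t − δ: |Δℓ(δ,s,t)| ≤ C·( s^{2H}·δ/t + (t−s)^{2H−1}·(1 − δ/t)^{2H−1}·δ·s/t + (t−s−δ)^{2H−1}·δ·s / (t·(t−s)^{2H}) ). -/
open Real

/-- `ℓ(x) = |1+x|^{2H} − |1−x|^{2H}`. -/
noncomputable def ell (H x : ℝ) : ℝ := |1 + x| ^ (2*H) - |1 - x| ^ (2*H)

/-- `Δℓ(δ,s,t) = (t^{2H}/2)·ℓ(δ/t) − ((t−s)^{2H}/2)·ℓ(δ/(t−s))`. -/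
noncomputable def deltaEll (H δ s t : ℝ) : ℝ :=
  (t ^ (2*H) / 2) * ell H (δ / t) - ((t - s) ^ (2*H) / 2) * ell H (δ / (t - s))

/-- The symmetric increment `(x + δ)^a - (x - δ)^a` of the power function. -/
noncomputable def powIncrement (a δ x : ℝ) : ℝ := (x + δ) ^ a - (x - δ) ^ a

theorem rpow_mul_ell {H δ x : ℝ} (hδ : 0 < δ) (hx : δ < x) :
    x ^ (2*H) * ell H (δ / x) = powIncrement (2*H) δ x := by
  have hx0 : 0 < x := hδ.trans hx
  have h1 : 0 ≤ 1 + δ / x := by positivity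
  have h2 : 0 ≤ 1 - δ / x := by
    rw [sub_nonneg, div_le_one hx0]; exact hx.le
  rw [ell, powIncrement, abs_of_nonneg h1, abs_of_nonneg h2, mul_sub,
    ← mul_rpow hx0.le h1, ← mul_rpow hx0.le h2]
  congr 2 <;> field_simp

theorem rpow_sub_rpow_le_rpow_sub {a x y : ℝ} (ha0 : 0 ≤ a) (ha1 : a ≤ 1) (hx : 0 ≤ x)
    (hxy : x ≤ y) : y ^ a - x ^ a ≤ (y - x) ^ a := by
  have h := rpow_add_le_add_rpow hx (sub_nonneg.2 hxy) ha0 ha1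
  rw [add_sub_cancel] at h
  linarith

theorem powIncrement_nonneg {a δ x : ℝ} (ha0 : 0 ≤ a) (hδ : 0 ≤ δ) (hx : δ ≤ x) :
    0 ≤ powIncrement a δ x :=
  sub_nonneg.2 (rpow_le_rpow (by linarith) (by linarith) ha0)

theorem powIncrement_le {a δ x : ℝ} (ha1 : a ≤ 1) (hδ : 0 < δ) (hx : δ < x) :
    powIncrement a δ x ≤ 2 * δ * (x - δ) ^ (a - 1) := by
  have hd : 0 < x - δ := sub_pos.2 hx
  have hr : 0 ≤ 2 * δ / (x - δ) := by positivity
  have hB : (1 + 2 * δ / (x - δ)) ^ a ≤ 1 + 2 * δ / (x - δ) := by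
    calc (1 + 2 * δ / (x - δ)) ^ a ≤ (1 + 2 * δ / (x - δ)) ^ (1 : ℝ) :=
          rpow_le_rpow_of_exponent_le (by linarith) ha1
      _ = _ := rpow_one _
  have hp : (x + δ) ^ a = (x - δ) ^ a * (1 + 2 * δ / (x - δ)) ^ a := by
    rw [← mul_rpow hd.le (by positivity)]
    congr 1; field_simp; ring
  have hm := mul_le_mul_of_nonneg_left hB (rpow_nonneg hd.le a)
  rw [powIncrement, hp, rpow_sub_one hd.ne']
  calc _ ≤ (x - δ) ^ a * (1 + 2 * δ / (x - δ)) - (x - δ) ^ a := by linarith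
    _ = _ := by ring

theorem exists_powIncrement_sub_eq {a δ u t : ℝ} (hδ : 0 < δ) (hu : δ < u) (hut : u < t) :
    ∃ c ∈ Set.Ioo u t, powIncrement a δ u - powIncrement a δ t =
      (t - u) * (a * ((c - δ) ^ (a - 1) - (c + δ) ^ (a - 1))) := by
  have hderiv : ∀ x, δ < x → HasDerivAt (powIncrement a δ)
      (a * (x + δ) ^ (a - 1) - a * (x - δ) ^ (a - 1)) x := by
    intro x hx
    have h1 := ((hasDerivAt_id x).add_const δ).rpow_const (p := a)
      (Or.inl (by simp only [id]; linarith))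
    have h2 := ((hasDerivAt_id x).sub_const δ).rpow_const (p := a)
      (Or.inl (by simp only [id]; linarith))
    have h := h1.sub h2
    simp only [id, one_mul] at h
    exact h
  obtain ⟨c, hc, h⟩ := exists_hasDerivAt_eq_slope (powIncrement a δ) _ hut
    (fun x hx => (hderiv x (hu.trans_le hx.1)).continuousAt.continuousWithinAt)
    (fun x hx => hderiv x (hu.trans hx.1))
  refine ⟨c, hc, ?_⟩
  rw [eq_div_iff (sub_pos.2 hut).ne'] at h
  linarith

theorem powIncrement_antitone {a δ u t : ℝ} (ha0 : 0 ≤ a) (ha1 : a ≤ 1) (hδ : 0 < δ)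
    (hu : δ < u) (hut : u < t) : powIncrement a δ t ≤ powIncrement a δ u := by
  obtain ⟨c, hc, h⟩ := exists_powIncrement_sub_eq (a := a) hδ hu hut
  have hc1 := hc.1
  have : (c + δ) ^ (a - 1) ≤ (c - δ) ^ (a - 1) :=
    rpow_le_rpow_of_nonpos (by linarith) (by linarith) (by linarith)
  rw [← sub_nonneg, h]
  exact mul_nonneg (by linarith) (mul_nonneg ha0 (by linarith))

theorem powIncrement_sub_le {a δ u t : ℝ} (ha0 : 0 ≤ a) (ha1 : a ≤ 1) (hδ : 0 < δ)
    (hu : δ < u) (hut : u < t) :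
    powIncrement a δ u - powIncrement a δ t ≤ (t - u) * (2 * δ * (u - δ) ^ (a - 1) / u) := by
  obtain ⟨c, ⟨huc, -⟩, h⟩ := exists_powIncrement_sub_eq (a := a) hδ hu hut
  have hd : 0 < c - δ := by linarith
  have hs : 0 < c + δ := by linarith
  rw [h]
  refine mul_le_mul_of_nonneg_left ?_ (by linarith)
  have hmono : (c + δ) ^ (a - 1) ≤ (c - δ) ^ (a - 1) :=
    rpow_le_rpow_of_nonpos hd (by linarith) (by linarith)
  have hratio : (c - δ) / (c + δ) ≤ ((c - δ) / (c + δ)) ^ (1 - a) := by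
    refine self_le_rpow_of_le_one (by positivity) ?_ (by linarith)
    rw [div_le_one hs]; linarith
  have hsplit : (c + δ) ^ (a - 1) = (c - δ) ^ (a - 1) * ((c - δ) / (c + δ)) ^ (1 - a) := by
    rw [div_rpow hd.le hs.le, ← mul_div_assoc, ← rpow_add hd, ← neg_sub 1 a, rpow_neg hs.le]
    simp
  have hm := mul_le_mul_of_nonneg_left hratio (rpow_nonneg hd.le (a - 1))
  calc a * ((c - δ) ^ (a - 1) - (c + δ) ^ (a - 1))
      ≤ (c - δ) ^ (a - 1) - (c + δ) ^ (a - 1) :=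
        mul_le_of_le_one_left (sub_nonneg.2 hmono) ha1
    _ ≤ (c - δ) ^ (a - 1) - (c - δ) ^ (a - 1) * ((c - δ) / (c + δ)) := by
        rw [hsplit]; linarith
    _ = 2 * δ * (c - δ) ^ (a - 1) / (c + δ) := by field_simp; ring
    _ ≤ 2 * δ * (u - δ) ^ (a - 1) / u := by
        have : (c - δ) ^ (a - 1) ≤ (u - δ) ^ (a - 1) :=
          rpow_le_rpow_of_nonpos (by linarith) (by linarith) (by linarith)
        have hu0 : 0 < u := hδ.trans hu
        have hp : 0 ≤ (u - δ) ^ (a - 1) := rpow_nonneg (by linarith) _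
        gcongr
        linarith

theorem powIncrement_sub_le_of_two_mul_le {a δ u t : ℝ} (ha0 : 0 ≤ a) (ha1 : a ≤ 1)
    (hδ : 0 < δ) (hu : 2 * δ ≤ u) (hut : u < t) :
    powIncrement a δ u - powIncrement a δ t ≤ 8 * (u ^ (a - 1) * δ * (t - u) / t) := by
  have hu0 : 0 < u := by linarith
  have ht0 : 0 < t := by linarith
  have hδu : δ < u := by linarith
  have hpow : (u - δ) ^ (a - 1) ≤ 2 * u ^ (a - 1) := by
    calc (u - δ) ^ (a - 1) ≤ (u / 2) ^ (a - 1) :=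
          rpow_le_rpow_of_nonpos (by linarith) (by linarith) (by linarith)
      _ = u ^ (a - 1) * 2 ^ (1 - a) := by
          rw [div_rpow hu0.le zero_le_two, ← neg_sub 1 a, rpow_neg zero_le_two, div_inv_eq_mul]
      _ ≤ u ^ (a - 1) * 2 ^ (1 : ℝ) := by
          gcongr
          · norm_num
          · linarith
      _ = 2 * u ^ (a - 1) := by rw [rpow_one, mul_comm]
  have hpos : 0 ≤ u ^ (a - 1) := rpow_nonneg hu0.le _
  rcases le_total (t - u) u with h | h
  · calc _ ≤ (t - u) * (2 * δ * (u - δ) ^ (a - 1) / u) := powIncrement_sub_le ha0 ha1 hδ hδu hut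
      _ ≤ (t - u) * (2 * δ * (2 * u ^ (a - 1)) / (t / 2)) := by
          have : 0 ≤ t - u := by linarith
          gcongr
          linarith
      _ = _ := by ring
  · calc _ ≤ powIncrement a δ u :=
          sub_le_self _ (powIncrement_nonneg ha0 hδ.le (by linarith))
      _ ≤ 2 * δ * (u - δ) ^ (a - 1) := powIncrement_le ha1 hδ hδu
      _ ≤ 2 * δ * (2 * u ^ (a - 1)) := by gcongr
      _ = 8 * (u ^ (a - 1) * δ * (1 / 2)) := by ring
      _ ≤ 8 * (u ^ (a - 1) * δ * ((t - u) / t)) := by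
          gcongr 8 * (u ^ (a - 1) * δ * ?_)
          rw [div_le_div_iff₀ two_pos ht0]; linarith
      _ = _ := by ring

theorem powIncrement_sub_le_of_le_two_mul {a δ u t : ℝ} (ha0 : 0 ≤ a) (ha1 : a ≤ 1)
    (hδ : 0 < δ) (hδu : δ < u) (hu : u ≤ 2 * δ) (hut : u < t) :
    powIncrement a δ u - powIncrement a δ t ≤
      8 * ((t - u) ^ a * δ / t + u ^ (a - 1) * δ * (t - u) / t) := by
  have hu0 : 0 < u := by linarith
  have ht0 : 0 < t := by linarith
  have hs0 : 0 < t - u := by linarith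
  have hp1 : 0 ≤ (t - u) ^ a * δ / t := by positivity
  have hp2 : 0 ≤ u ^ (a - 1) * δ * (t - u) / t := by positivity
  rcases le_total (t - u) δ with h | h
  · have hmono : (u + δ) ^ a ≤ (t + δ) ^ a := rpow_le_rpow (by linarith) (by linarith) ha0
    have hsub := rpow_sub_rpow_le_rpow_sub (x := u - δ) (y := t - δ) ha0 ha1
      (by linarith) (by linarith)
    rw [sub_sub_sub_cancel_right] at hsub
    have hthird : (t - u) ^ a * (1 / 3) ≤ (t - u) ^ a * (δ / t) := by
      gcongr (t - u) ^ a * ?_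
      rw [div_le_div_iff₀ three_pos ht0]; linarith
    rw [← mul_div_assoc _ δ] at hthird
    unfold powIncrement
    have := rpow_nonneg hs0.le a
    linarith
  · have hsub := rpow_sub_rpow_le_rpow_sub (x := u - δ) (y := u + δ) ha0 ha1
      (by linarith) (by linarith)
    have hnn := powIncrement_nonneg (x := t) ha0 hδ.le (by linarith)
    have heq : (u + δ - (u - δ)) ^ a = (2 * δ) ^ (a - 1) * (2 * δ) := by
      rw [rpow_sub_one (by positivity), div_mul_cancel₀ _ (by positivity)]
      congr 1; ring
    have hmono : (2 * δ) ^ (a - 1) ≤ u ^ (a - 1) :=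
      rpow_le_rpow_of_nonpos hu0 hu (by linarith)
    have hprod : (2 * δ) ^ (a - 1) * (2 * δ) ≤ u ^ (a - 1) * (2 * δ) := by gcongr
    have hthird : u ^ (a - 1) * δ * (1 / 3) ≤ u ^ (a - 1) * δ * ((t - u) / t) := by
      gcongr u ^ (a - 1) * δ * ?_
      rw [div_le_div_iff₀ three_pos ht0]; linarith
    rw [← mul_div_assoc _ (t - u)] at hthird
    rw [heq] at hsub
    change powIncrement a δ u ≤ _ at hsub
    linarith

theorem deltaEll_bound (H : ℝ) (h0 : 0 < H) (h1 : H < 1/2) :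
    ∃ C > 0, ∀ δ ∈ Set.Ioo (0:ℝ) 1, ∀ s t : ℝ, 0 < s → s < t - δ →
      |deltaEll H δ s t| ≤
        C * (s ^ (2*H) * δ / t
          + (t - s) ^ (2*H - 1) * (1 - δ / t) ^ (2*H - 1) * δ * s / t
          + (t - s - δ) ^ (2*H - 1) * δ * s / (t * (t - s) ^ (2*H))) := by
  refine ⟨4, by norm_num, ?_⟩
  rintro δ ⟨hδ, -⟩ s t hs hst
  have ha0 : 0 ≤ 2 * H := by linarith
  have ha1 : 2 * H ≤ 1 := by linarith
  have hδu : δ < t - s := by linarith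
  have hut : t - s < t := by linarith
  have hu0 : 0 < t - s := by linarith
  have ht0 : 0 < t := by linarith
  have hd0 : 0 < t - s - δ := by linarith
  have hΔ : deltaEll H δ s t =
      -((powIncrement (2*H) δ (t - s) - powIncrement (2*H) δ t) / 2) := by
    rw [← rpow_mul_ell hδ hδu, ← rpow_mul_ell hδ (hδu.trans hut), deltaEll]
    ring
  have hnn : 0 ≤ (powIncrement (2*H) δ (t - s) - powIncrement (2*H) δ t) / 2 :=
    div_nonneg (sub_nonneg.2 (powIncrement_antitone ha0 ha1 hδ hδu hut)) zero_le_two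
  have hfirst : 0 ≤ s ^ (2*H) * δ / t := by positivity
  have hthird : 0 ≤ (t - s - δ) ^ (2*H - 1) * δ * s / (t * (t - s) ^ (2*H)) := by positivity
  have hfactor : 1 ≤ (1 - δ / t) ^ (2*H - 1) := by
    refine one_le_rpow_of_pos_of_le_one_of_nonpos ?_ ?_ (by linarith)
    · rw [sub_pos, div_lt_one ht0]; linarith
    · exact sub_le_self _ (by positivity)
  have hsecond : (t - s) ^ (2*H - 1) * δ * s / t ≤
      (t - s) ^ (2*H - 1) * (1 - δ / t) ^ (2*H - 1) * δ * s / t := by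
    gcongr
    exact le_mul_of_one_le_right (by positivity) hfactor
  have hmain : powIncrement (2*H) δ (t - s) - powIncrement (2*H) δ t ≤
      8 * (s ^ (2*H) * δ / t + (t - s) ^ (2*H - 1) * δ * s / t) := by
    rcases le_total (2 * δ) (t - s) with h | h
    · have := powIncrement_sub_le_of_two_mul_le ha0 ha1 hδ h hut
      rw [sub_sub_cancel] at this
      linarith
    · have := powIncrement_sub_le_of_le_two_mul ha0 ha1 hδ hδu h hut
      rwa [sub_sub_cancel] at this
  rw [hΔ, abs_neg, abs_of_nonneg hnn]
  linarith
end

section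
/- Let 0 < H < 1/2. For all ε, δ > 0 and all s,t with s ≥ ε and t − s > ε + δ, one has (1/(4εδ))·| R(s+ε, t+δ) + R(s−ε, t−δ) − R(s−ε, t+δ) − R(s+ε, t−δ) | ≤ H·(1−2H)·( t − s − (ε+δ) )^{2H−2}. -/
open Real

open Set in
/-- Two applications of the mean value theorem express a mixed second difference of `x ^ a`
through its second derivative. -/
theorem exists_rpow_mixed_second_difference_eq (a : ℝ) {u ε δ : ℝ} (hε : 0 < ε) (hδ : 0 < δ)
    (hu : ε + δ < u) :
    ∃ η, u - (ε + δ) < η ∧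
      (u + δ + ε) ^ a - (u + δ - ε) ^ a - ((u - δ + ε) ^ a - (u - δ - ε) ^ a)
        = 4 * ε * δ * (a * (a - 1) * η ^ (a - 2)) := by
  have hd : ∀ x ∈ Icc (u - δ) (u + δ), HasDerivAt (fun x : ℝ => (x + ε) ^ a - (x - ε) ^ a)
      (a * (x + ε) ^ (a - 1) - a * (x - ε) ^ (a - 1)) x := by
    intro x hx
    have h₁ := ((hasDerivAt_id x).add_const ε).rpow_const (p := a)
      (Or.inl (by simp only [id]; linarith [hx.1]))
    have h₂ := ((hasDerivAt_id x).sub_const ε).rpow_const (p := a)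
      (Or.inl (by simp only [id]; linarith [hx.1]))
    simpa using! h₁.sub h₂
  obtain ⟨ξ, hξ, hξ_eq⟩ := exists_hasDerivAt_eq_slope _ _ (by linarith : u - δ < u + δ)
    (fun x hx => (hd x hx).continuousAt.continuousWithinAt)
    (fun x hx => hd x (Ioo_subset_Icc_self hx))
  have hd' : ∀ x ∈ Icc (ξ - ε) (ξ + ε), HasDerivAt (fun x : ℝ => a * x ^ (a - 1))
      (a * ((a - 1) * x ^ (a - 1 - 1))) x := fun x hx =>
    (Real.hasDerivAt_rpow_const (Or.inl (by linarith [hx.1, hξ.1]))).const_mul a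
  obtain ⟨η, hη, hη_eq⟩ := exists_hasDerivAt_eq_slope _ _ (by linarith : ξ - ε < ξ + ε)
    (fun x hx => (hd' x hx).continuousAt.continuousWithinAt)
    (fun x hx => hd' x (Ioo_subset_Icc_self hx))
  refine ⟨η, by linarith [hη.1, hξ.1], ?_⟩
  rw [eq_div_iff (by linarith)] at hξ_eq hη_eq
  rw [show a - 1 - 1 = a - 2 by ring] at hη_eq
  linear_combination -hξ_eq - 2 * δ * hη_eq

theorem finite_difference_off_diagonal_bound
    (H : ℝ) (h0 : 0 < H) (h1 : H < 1/2) :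
    ∀ ε > (0:ℝ), ∀ δ > (0:ℝ), ∀ s t : ℝ, ε ≤ s → ε + δ < t - s →
      (1 / (4 * ε * δ)) *
        |fbmR H (s + ε) (t + δ) + fbmR H (s - ε) (t - δ)
          - fbmR H (s - ε) (t + δ) - fbmR H (s + ε) (t - δ)|
        ≤ H * (1 - 2*H) * (t - s - (ε + δ)) ^ (2*H - 2) := by
  intro ε hε δ hδ s t _ hst
  obtain ⟨η, hη, hη_eq⟩ :=
    exists_rpow_mixed_second_difference_eq (2 * H) (u := t - s) hε hδ hst
  have hbase : 0 < t - s - (ε + δ) := by linarith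
  have hdiff : fbmR H (s + ε) (t + δ) + fbmR H (s - ε) (t - δ)
      - fbmR H (s - ε) (t + δ) - fbmR H (s + ε) (t - δ)
      = -(4 * ε * δ * (H * (1 - 2 * H) * η ^ (2 * H - 2))) := by
    unfold fbmR
    rw [abs_of_pos (by linarith : 0 < t + δ - (s + ε)),
      abs_of_pos (by linarith : 0 < t - δ - (s - ε)),
      abs_of_pos (by linarith : 0 < t + δ - (s - ε)),
      abs_of_pos (by linarith : 0 < t - δ - (s + ε)),
      show t + δ - (s + ε) = t - s + δ - ε by ring,
      show t - δ - (s - ε) = t - s - δ + ε by ring,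
      show t + δ - (s - ε) = t - s + δ + ε by ring,
      show t - δ - (s + ε) = t - s - δ - ε by ring]
    linear_combination hη_eq / 2
  have hη_pos : 0 < η := hbase.trans hη
  have hcoef : 0 ≤ H * (1 - 2 * H) := mul_nonneg h0.le (by linarith)
  rw [hdiff, abs_neg, abs_of_nonneg (by positivity), one_div,
    inv_mul_cancel_left₀ (by positivity)]
  exact mul_le_mul_of_nonneg_left
    (Real.rpow_le_rpow_of_nonpos hbase hη.le (by linarith)) hcoef
end

section
/- Let 0 < H < 1/2. For all real numbers 0 < s < t, one has the strict inequality H·( (t−s)^{2H−1} − t^{2H−1} ) < (t−s)^{2H−1}·s/t. -/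
open Real

theorem partial_R_strict_bound (H : ℝ) (h0 : 0 < H) (h1 : H < 1/2) :
    ∀ s t : ℝ, 0 < s → s < t →
      H * ((t - s) ^ (2*H - 1) - t ^ (2*H - 1)) < (t - s) ^ (2*H - 1) * s / t := by
  intro s t hs hst
  have ht : 0 < t := hs.trans hst
  have hu : 0 < t - s := sub_pos.2 hst
  have mul_self_rpow : ∀ x : ℝ, 0 < x → x ^ (2*H - 1) * x = x ^ (2*H) := fun x hx => by
    rw [rpow_sub_one hx.ne', div_mul_cancel₀ _ hx.ne']
  have hmono : (t - s) ^ (2*H) < t ^ (2*H) :=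
    rpow_lt_rpow hu.le (by linarith) (by linarith)
  rw [← mul_self_rpow _ hu, ← mul_self_rpow _ ht] at hmono
  have hpos : 0 < (t - s) ^ (2*H - 1) * s := mul_pos (rpow_pos_of_pos hu _) hs
  rw [lt_div_iff₀ ht]
  calc H * ((t - s) ^ (2*H - 1) - t ^ (2*H - 1)) * t
      = H * (((t - s) ^ (2*H - 1) - t ^ (2*H - 1)) * t) := mul_assoc _ _ _
    _ < H * ((t - s) ^ (2*H - 1) * s) := mul_lt_mul_of_pos_left (by linarith) h0
    _ < (t - s) ^ (2*H - 1) * s := mul_lt_of_lt_one_left hpos (by linarith)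
end

section
/- Let 0 < H < 1/2, T > 0 and 1 ≤ q < 1/(1−H). Then the kernel κ(s,t) := (min(s,t))^{H−1}·|t−s|^{H−1} + |t−s|^{2H−1}/max(s,t) satisfies ∫∫_{(0,T)×(0,T)} κ(s,t)^q ds dt < ∞. -/
open Real MeasureTheory

/-- The kernel `κ(s,t) = (s∧t)^{H−1}·|t−s|^{H−1} + |t−s|^{2H−1}/(s∨t)`. -/
noncomputable def kernelKappa (H s t : ℝ) : ℝ :=
  (min s t) ^ (H - 1) * |t - s| ^ (H - 1) + |t - s| ^ (2*H - 1) / max s t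

theorem kernelKappa_comm (H s t : ℝ) : kernelKappa H s t = kernelKappa H t s := by
  simp only [kernelKappa, min_comm s t, max_comm s t, abs_sub_comm t s]

theorem kernelKappa_nonneg (H : ℝ) {s t : ℝ} (hs : 0 ≤ s) (ht : 0 ≤ t) :
    0 ≤ kernelKappa H s t := by
  have hmin : 0 ≤ min s t := le_min hs ht
  have hmax : 0 ≤ max s t := le_max_of_le_left hs
  unfold kernelKappa
  positivity

theorem kernelKappa_self {H : ℝ} (hH : H < 1 / 2) (s : ℝ) : kernelKappa H s s = 0 := by
  simp [kernelKappa, Real.zero_rpow (show H - 1 ≠ 0 by linarith),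
    Real.zero_rpow (show 2 * H - 1 ≠ 0 by linarith)]

theorem measurable_kernelKappa (H : ℝ) :
    Measurable fun p : ℝ × ℝ => kernelKappa H p.1 p.2 := by
  unfold kernelKappa
  simp only [← Real.norm_eq_abs]
  fun_prop

theorem kernelKappa_le {H s t : ℝ} (h0 : 0 ≤ H) (h1 : H ≤ 1) (hs : 0 < s) (hst : s < t) :
    kernelKappa H s t ≤ 2 * (s ^ (H - 1) * (t - s) ^ (H - 1)) := by
  have hd : 0 < t - s := sub_pos.mpr hst
  have ht : 0 < t := hs.trans hst
  have hinv : t⁻¹ ≤ s ^ (H - 1) * (t - s) ^ (-H) := by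
    calc t⁻¹ = t ^ (H - 1) * t ^ (-H) := by
          rw [← Real.rpow_add ht, ← Real.rpow_neg_one]; ring_nf
      _ ≤ s ^ (H - 1) * (t - s) ^ (-H) := by
          gcongr ?_ * ?_
          · exact Real.rpow_le_rpow_of_nonpos hs hst.le (by linarith)
          · exact Real.rpow_le_rpow_of_nonpos hd (by linarith) (by linarith)
  have hsecond : (t - s) ^ (2 * H - 1) / t ≤ s ^ (H - 1) * (t - s) ^ (H - 1) := by
    calc (t - s) ^ (2 * H - 1) / t
        ≤ (t - s) ^ (2 * H - 1) * (s ^ (H - 1) * (t - s) ^ (-H)) := by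
          rw [div_eq_mul_inv]; gcongr
      _ = s ^ (H - 1) * ((t - s) ^ (2 * H - 1) * (t - s) ^ (-H)) := by ring
      _ = s ^ (H - 1) * (t - s) ^ (H - 1) := by
          rw [← Real.rpow_add hd]; ring_nf
  rw [kernelKappa, min_eq_left hst.le, max_eq_right hst.le, abs_of_pos hd]
  linarith

theorem kernelKappa_rpow_le {H q s t : ℝ} (h0 : 0 ≤ H) (h1 : H ≤ 1) (hq : 0 ≤ q) (hs : 0 < s)
    (hst : s < t) :
    kernelKappa H s t ^ q ≤ 2 ^ q * (s ^ ((H - 1) * q) * (t - s) ^ ((H - 1) * q)) := by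
  have hd : 0 < t - s := sub_pos.mpr hst
  calc kernelKappa H s t ^ q ≤ (2 * (s ^ (H - 1) * (t - s) ^ (H - 1))) ^ q :=
        Real.rpow_le_rpow (kernelKappa_nonneg H hs.le (hs.trans hst).le)
          (kernelKappa_le h0 h1 hs hst) hq
    _ = 2 ^ q * (s ^ ((H - 1) * q) * (t - s) ^ ((H - 1) * q)) := by
        rw [Real.mul_rpow (by norm_num) (by positivity),
          Real.mul_rpow (by positivity) (by positivity), ← Real.rpow_mul hs.le,
          ← Real.rpow_mul hd.le]

theorem integrable_indicator_Ioo_rpow {b T : ℝ} (hb : -1 < b) (hT : 0 ≤ T) :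
    Integrable ((Set.Ioo 0 T).indicator fun x : ℝ => x ^ b) := by
  rw [integrable_indicator_iff measurableSet_Ioo]
  exact ((intervalIntegrable_iff_integrableOn_Ioc_of_le hT).mp
    (intervalIntegral.intervalIntegrable_rpow' hb)).mono_set Set.Ioo_subset_Ioc_self

theorem kernelKappa_q_integrable (H T q : ℝ) (h0 : 0 < H) (h1 : H < 1/2)
    (hT : 0 < T) (hq1 : 1 ≤ q) (hq2 : q < 1 / (1 - H)) :
    IntegrableOn (fun p : ℝ × ℝ => (kernelKappa H p.1 p.2) ^ q)
      (Set.Ioo 0 T ×ˢ Set.Ioo 0 T) := by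
  have hb : -1 < (H - 1) * q := by
    rw [lt_div_iff₀ (by linarith)] at hq2
    linarith
  set b := (H - 1) * q
  set f : ℝ → ℝ := (Set.Ioo 0 T).indicator fun x => x ^ b
  have hf : Integrable f := integrable_indicator_Ioo_rpow hb hT.le
  have hf_nonneg (x : ℝ) : 0 ≤ f x :=
    Set.indicator_nonneg (fun y hy => Real.rpow_nonneg hy.1.le b) x
  have hf_apply {x : ℝ} (hx0 : 0 < x) (hxT : x < T) : f x = x ^ b :=
    Set.indicator_of_mem (Set.mem_Ioo.mpr ⟨hx0, hxT⟩) _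
  have hconv : Integrable (fun p : ℝ × ℝ => f p.2 * f (p.1 - p.2)) :=
    hf.convolution_integrand (ContinuousLinearMap.mul ℝ ℝ) hf
  have hdom : Integrable (fun p : ℝ × ℝ =>
      2 ^ q * (f p.1 * f (p.2 - p.1) + f p.2 * f (p.1 - p.2))) :=
    (hconv.swap.add hconv).const_mul _
  have hbound {s t : ℝ} (hs : 0 < s) (hst : s < t) (ht : t < T) :
      kernelKappa H s t ^ q ≤ 2 ^ q * (f s * f (t - s)) := by
    rw [hf_apply hs (hst.trans ht), hf_apply (sub_pos.mpr hst) (by linarith)]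
    exact kernelKappa_rpow_le h0.le (by linarith) (by linarith) hs hst
  refine hdom.integrableOn.mono' ((measurable_kernelKappa H).pow_const q).aestronglyMeasurable ?_
  refine (ae_restrict_iff' (measurableSet_Ioo.prod measurableSet_Ioo)).mpr (ae_of_all _ ?_)
  rintro ⟨s, t⟩ ⟨⟨hs0, hsT⟩, ht0, htT⟩
  dsimp only at hs0 hsT ht0 htT ⊢
  rw [Real.norm_of_nonneg (Real.rpow_nonneg (kernelKappa_nonneg H hs0.le ht0.le) q), mul_add]
  have hst_nonneg : 0 ≤ (2 : ℝ) ^ q * (f s * f (t - s)) :=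
    mul_nonneg (by positivity) (mul_nonneg (hf_nonneg _) (hf_nonneg _))
  have hts_nonneg : 0 ≤ (2 : ℝ) ^ q * (f t * f (s - t)) :=
    mul_nonneg (by positivity) (mul_nonneg (hf_nonneg _) (hf_nonneg _))
  rcases lt_trichotomy s t with hst | rfl | hst
  · linarith [hbound hs0 hst htT]
  · rw [kernelKappa_self h1, Real.zero_rpow (by linarith)]
    linarith
  · rw [kernelKappa_comm]
    linarith [hbound ht0 hst hsT]
end

section
/- Let 0 < H < 1/2 and γ > 1/(2H) − 1. There exists a constant C > 0, depending only on H and γ, such that for all 0 < δ ≤ ε < 1: ∫_0^{2ε+δ} u^{2Hγ} · | (u+ε+δ)^{2H} + |u−(ε+δ)|^{2H} − (u+ε−δ)^{2H} − |u−(ε−δ)|^{2H} | du ≤ C · ε^{2H+2Hγ} · δ. -/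
open Real MeasureTheory

theorem continuous_abs_rpow {a : ℝ} (ha : 0 ≤ a) : Continuous fun x : ℝ => |x| ^ a :=
  continuous_abs.rpow_const fun _ => Or.inr ha

theorem continuous_abs_rpow_symm_diff {a : ℝ} (ha : 0 ≤ a) (d : ℝ) :
    Continuous fun x : ℝ => |(|x + d| ^ a - |x - d| ^ a)| := by
  have := continuous_abs_rpow ha
  exact ((this.comp (by fun_prop : Continuous fun x : ℝ => x + d)).sub
    (this.comp (by fun_prop : Continuous fun x : ℝ => x - d))).abs

/-- The integral of a symmetric difference of `|x| ^ a` telescopes. -/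
theorem integral_abs_rpow_symm_diff_le {a d q : ℝ} (ha : 0 ≤ a) (hd : 0 ≤ d) (hq : d ≤ q) :
    ∫ x in (0 : ℝ)..q, |(|x + d| ^ a - |x - d| ^ a)| ≤ 2 * d * (q + d) ^ a := by
  have hc := continuous_abs_rpow ha
  have hi : ∀ s t : ℝ, IntervalIntegrable (fun x : ℝ => |x| ^ a) volume s t :=
    fun s t => hc.intervalIntegrable s t
  have h1 : ∫ x in (0 : ℝ)..q, |(|x + d| ^ a - |x - d| ^ a)|
      = ∫ x in (0 : ℝ)..q, (|x + d| ^ a - |x - d| ^ a) := by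
    refine intervalIntegral.integral_congr fun x hx => ?_
    rw [Set.uIcc_of_le (by linarith)] at hx
    refine abs_of_nonneg (sub_nonneg.2 (rpow_le_rpow (abs_nonneg _) ?_ ha))
    rw [abs_of_nonneg (a := x + d) (by linarith [hx.1]), abs_le]
    constructor <;> linarith [hx.1]
  have h2 : ∫ x in (0 : ℝ)..q, (|x + d| ^ a - |x - d| ^ a)
      = (∫ x in (0 + d)..(q + d), |x| ^ a) - ∫ x in (0 - d)..(q - d), |x| ^ a := by
    have c1 : Continuous fun x : ℝ => |x + d| ^ a := hc.comp (continuous_add_const d)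
    have c2 : Continuous fun x : ℝ => |x - d| ^ a := hc.comp (continuous_sub_right d)
    rw [intervalIntegral.integral_sub (c1.intervalIntegrable _ _) (c2.intervalIntegrable _ _),
      intervalIntegral.integral_comp_add_right (fun x : ℝ => |x| ^ a),
      intervalIntegral.integral_comp_sub_right (fun x : ℝ => |x| ^ a)]
  have h3 := intervalIntegral.integral_interval_sub_interval_comm
    (hi (0 + d) (q + d)) (hi (0 - d) (q - d)) (hi (0 + d) (0 - d))
  have h4 : 0 ≤ ∫ x in (0 - d)..(0 + d), |x| ^ a :=
    intervalIntegral.integral_nonneg (by linarith) fun x _ => by positivity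
  have h5 : ∫ x in (q - d)..(q + d), |x| ^ a ≤ ∫ _ in (q - d)..(q + d), (q + d) ^ a := by
    refine intervalIntegral.integral_mono_on (by linarith) (hi _ _) (by simp) fun x hx => ?_
    refine rpow_le_rpow (abs_nonneg _) ?_ ha
    rw [abs_le]
    constructor <;> linarith [hx.1, hx.2]
  rw [intervalIntegral.integral_const, smul_eq_mul] at h5
  rw [intervalIntegral.integral_symm (0 - d) (0 + d),
    intervalIntegral.integral_symm (q - d) (q + d)] at h3
  rw [h1, h2, h3]
  linarith

theorem integral_abs_rpow_symm_diff_le_of_subset {a d q s t : ℝ} (ha : 0 ≤ a) (hd : 0 ≤ d)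
    (hq : d ≤ q) (hs : -q ≤ s) (hst : s ≤ t) (ht : t ≤ q) :
    ∫ x in s..t, |(|x + d| ^ a - |x - d| ^ a)| ≤ 4 * d * (q + d) ^ a := by
  have hi := fun s t : ℝ =>
    (continuous_abs_rpow_symm_diff ha d).intervalIntegrable (μ := volume) s t
  have h1 : ∫ x in s..t, |(|x + d| ^ a - |x - d| ^ a)|
      ≤ ∫ x in (-q)..q, |(|x + d| ^ a - |x - d| ^ a)| :=
    intervalIntegral.integral_mono_interval hs hst ht
      (Filter.Eventually.of_forall fun x => abs_nonneg _) (hi _ _)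
  have h2 : ∫ x in (-q)..0, |(|x + d| ^ a - |x - d| ^ a)|
      = ∫ x in (0 : ℝ)..q, |(|x + d| ^ a - |x - d| ^ a)| := by
    rw [← neg_zero, ← intervalIntegral.integral_comp_neg, neg_zero]
    refine intervalIntegral.integral_congr fun x _ => ?_
    have e1 : |-x + d| = |x - d| := by rw [← abs_neg]; ring_nf
    have e2 : |-x - d| = |x + d| := by rw [← abs_neg]; ring_nf
    simp only [e1, e2]
    exact abs_sub_comm _ _
  rw [← intervalIntegral.integral_add_adjacent_intervals (hi (-q) 0) (hi 0 q), h2] at h1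
  linarith [integral_abs_rpow_symm_diff_le ha hd hq]

theorem diagonal_integral_bound (H γ : ℝ) (h0 : 0 < H) (h1 : H < 1/2)
    (hγ : γ > 1 / (2*H) - 1) :
    ∃ C > 0, ∀ ε δ : ℝ, 0 < δ → δ ≤ ε → ε < 1 →
      ∫ u in Set.Ioo (0:ℝ) (2*ε + δ),
        u ^ (2*H*γ) *
          |(u + ε + δ) ^ (2*H) + |u - (ε + δ)| ^ (2*H)
            - (u + ε - δ) ^ (2*H) - |u - (ε - δ)| ^ (2*H)|
        ≤ C * ε ^ (2*H + 2*H*γ) * δ := by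
  have ha : 0 ≤ 2 * H := by linarith
  have hb : 0 ≤ 2 * H * γ := by
    have : 1 < 1 / (2 * H) := by rw [lt_div_iff₀] <;> linarith
    exact mul_nonneg ha (by linarith)
  generalize 2 * H * γ = b at *
  generalize 2 * H = a at *
  refine ⟨3 ^ b * (8 * 5 ^ a), by positivity, fun ε δ hδ hδε _ => ?_⟩
  have hε : 0 < ε := hδ.trans_le hδε
  set h : ℝ → ℝ := fun x => |(|x + δ| ^ a - |x - δ| ^ a)| with hh
  have hc : Continuous h := continuous_abs_rpow_symm_diff ha δ
  have hc1 : Continuous fun u => h (u + ε) := by fun_prop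
  have hc2 : Continuous fun u => h (u - ε) := by fun_prop
  have hle : (0 : ℝ) ≤ 2 * ε + δ := by linarith
  have key : ∫ u in Set.Ioo (0:ℝ) (2*ε + δ),
        u ^ b * |(u + ε + δ) ^ a + |u - (ε + δ)| ^ a
            - (u + ε - δ) ^ a - |u - (ε - δ)| ^ a|
      ≤ ∫ u in Set.Ioo (0:ℝ) (2*ε + δ), (3 * ε) ^ b * (h (u + ε) + h (u - ε)) := by
    refine integral_mono_of_nonneg ?_ ?_ ?_
    · filter_upwards [ae_restrict_mem measurableSet_Ioo] with u hu
      have := hu.1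
      simp only [Pi.zero_apply]
      positivity
    · exact ((continuous_const.mul (hc1.add hc2)).integrableOn_Icc (a := 0)
        (b := 2 * ε + δ)).mono_set Set.Ioo_subset_Icc_self
    · filter_upwards [ae_restrict_mem measurableSet_Ioo] with u hu
      obtain ⟨hu0, hu1⟩ := hu
      refine mul_le_mul (rpow_le_rpow hu0.le (by linarith) hb) ?_ (abs_nonneg _) (by positivity)
      have e1 : |u + ε + δ| = u + ε + δ := abs_of_nonneg (by linarith)
      have e2 : |u + ε - δ| = u + ε - δ := abs_of_nonneg (by linarith)
      have e3 : u - ε + δ = u - (ε - δ) := by ring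
      have e4 : u - ε - δ = u - (ε + δ) := by ring
      simp only [hh, e1, e2, e3, e4]
      rw [abs_sub_comm (|u - (ε - δ)| ^ a)]
      refine le_trans (le_of_eq ?_) (abs_add_le _ _)
      congr 1
      ring
  refine key.trans ?_
  rw [← integral_Ioc_eq_integral_Ioo, ← intervalIntegral.integral_of_le hle,
    intervalIntegral.integral_const_mul,
    intervalIntegral.integral_add (hc1.intervalIntegrable _ _) (hc2.intervalIntegrable _ _),
    intervalIntegral.integral_comp_add_right h, intervalIntegral.integral_comp_sub_right h]
  have b1 : ∫ x in (0 + ε)..(2 * ε + δ + ε), h x ≤ 4 * δ * (4 * ε + δ) ^ a :=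
    integral_abs_rpow_symm_diff_le_of_subset ha hδ.le
      (by linarith) (by linarith) (by linarith) (by linarith)
  have b2 : ∫ x in (0 - ε)..(2 * ε + δ - ε), h x ≤ 4 * δ * (4 * ε + δ) ^ a :=
    integral_abs_rpow_symm_diff_le_of_subset ha hδ.le
      (by linarith) (by linarith) (by linarith) (by linarith)
  have b3 : (4 * ε + δ) ^ a ≤ (5 * ε) ^ a := rpow_le_rpow (by positivity) (by linarith) ha
  calc _ ≤ (3 * ε) ^ b * (8 * δ * (5 * ε) ^ a) := by
        refine mul_le_mul_of_nonneg_left ?_ (by positivity)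
        have := mul_le_mul_of_nonneg_left b3 hδ.le
        linarith
    _ = _ := by
        rw [mul_rpow (by norm_num) hε.le, mul_rpow (by norm_num) hε.le, rpow_add hε]
        ring
end

section
/- Let 0 < H < 1/2 and T > 0. Define φ(s,t) := R(s,t) − s^{2H}, Θ_{s,t} := s^{2H}·t^{2H} − R(s,t)², η₁₂(s,t) := H·( s^{2H}·(t−s)^{2H−1} − s^{2H−1}·φ(s,t) )/Θ_{s,t} and η₂₂(s,t) := H·( s^{2H}·(t−s)^{2H−1} − φ(s,t)·( t^{2H−1} − (t−s)^{2H−1} ) )/Θ_{s,t}. Then there exists a constant C > 0, depending only on H and T, such that for all 0 < s < t ≤ T: |η₁₂(s,t)·η₂₂(s,t)|·(t−s)^{2H} ≤ C·( (t−s)^{2H−2} + s^{H−1}·(t−s)^{H−1} + (t−s)^{2H−1}/t ). -/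
open Real

/-- `φ(s,t) = R(s,t) − s^{2H}`. -/
noncomputable def fbmPhi (H s t : ℝ) : ℝ := fbmR H s t - s ^ (2*H)

/-- `η₁₂(s,t) = H·( s^{2H}·(t−s)^{2H−1} − s^{2H−1}·φ(s,t) )/Θ_{s,t}`. -/
noncomputable def eta12 (H s t : ℝ) : ℝ :=
  H * (s ^ (2*H) * (t - s) ^ (2*H - 1) - s ^ (2*H - 1) * fbmPhi H s t) / fbmTheta H s t

/-- `η₂₂(s,t) = H·( s^{2H}·(t−s)^{2H−1} − φ(s,t)·( t^{2H−1} − (t−s)^{2H−1} ) )/Θ_{s,t}`. -/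
noncomputable def eta22 (H s t : ℝ) : ℝ :=
  H * (s ^ (2*H) * (t - s) ^ (2*H - 1)
    - fbmPhi H s t * (t ^ (2*H - 1) - (t - s) ^ (2*H - 1))) / fbmTheta H s t

lemma fbmPhi_eq {H s t : ℝ} (hst : s < t) :
    fbmPhi H s t = -((s ^ (2*H) + (t - s) ^ (2*H) - t ^ (2*H)) / 2) := by
  rw [fbmPhi, fbmR, abs_of_pos (sub_pos.2 hst)]
  ring

/-- `Θ` is symmetric under exchanging the increments `[0, s]` and `[s, t]` (Heron's formula). -/
lemma fbmTheta_eq {H s t : ℝ} (hst : s < t) :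
    fbmTheta H s t = s ^ (2*H) * (t - s) ^ (2*H) - fbmPhi H s t ^ 2 := by
  rw [fbmPhi, fbmTheta, fbmR, abs_of_pos (sub_pos.2 hst)]
  ring

lemma fbmPhi_nonpos {H s t : ℝ} (h0 : 0 < H) (h1 : H < 1/2) (hs : 0 < s) (hst : s < t) :
    fbmPhi H s t ≤ 0 := by
  have h := Real.rpow_add_le_add_rpow hs.le (sub_pos.2 hst).le
    (by linarith : 0 ≤ 2*H) (by linarith : 2*H ≤ 1)
  rw [add_sub_cancel] at h
  rw [fbmPhi_eq hst]
  linarith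

lemma neg_fbmPhi_le_left {H s t : ℝ} (h0 : 0 < H) (hs : 0 < s) (hst : s < t) :
    -fbmPhi H s t ≤ s ^ (2*H) / 2 := by
  have h : (t - s) ^ (2*H) ≤ t ^ (2*H) :=
    Real.rpow_le_rpow (sub_pos.2 hst).le (by linarith) (by linarith)
  rw [fbmPhi_eq hst]
  linarith

lemma neg_fbmPhi_le_right {H s t : ℝ} (h0 : 0 < H) (hs : 0 < s) (hst : s < t) :
    -fbmPhi H s t ≤ (t - s) ^ (2*H) / 2 := by
  have h : s ^ (2*H) ≤ t ^ (2*H) := Real.rpow_le_rpow hs.le hst.le (by linarith)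
  rw [fbmPhi_eq hst]
  linarith

/-- Local nondeterminism of fractional Brownian motion. -/
lemma le_fbmTheta {H s t : ℝ} (h0 : 0 < H) (h1 : H < 1/2) (hs : 0 < s) (hst : s < t) :
    s ^ (2*H) * (t - s) ^ (2*H) / 2 ≤ fbmTheta H s t := by
  have h := mul_le_mul (neg_fbmPhi_le_left h0 hs hst) (neg_fbmPhi_le_right h0 hs hst)
    (neg_nonneg.2 (fbmPhi_nonpos h0 h1 hs hst)) (by positivity)
  have hpos : 0 < s ^ (2*H) * (t - s) ^ (2*H) :=
    mul_pos (Real.rpow_pos_of_pos hs _) (Real.rpow_pos_of_pos (sub_pos.2 hst) _)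
  rw [fbmTheta_eq hst]
  linarith

lemma fbmTheta_pos {H s t : ℝ} (h0 : 0 < H) (h1 : H < 1/2) (hs : 0 < s) (hst : s < t) :
    0 < fbmTheta H s t :=
  lt_of_lt_of_le (half_pos (mul_pos (Real.rpow_pos_of_pos hs _)
    (Real.rpow_pos_of_pos (sub_pos.2 hst) _))) (le_fbmTheta h0 h1 hs hst)

lemma neg_fbmPhi_le_geom_mean {H s t : ℝ} (h0 : 0 < H) (h1 : H < 1/2) (hs : 0 < s)
    (hst : s < t) : -fbmPhi H s t ≤ s ^ H * (t - s) ^ H := by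
  have hv := sub_pos.2 hst
  have hp := neg_nonneg.2 (fbmPhi_nonpos h0 h1 hs hst)
  have h := mul_le_mul (neg_fbmPhi_le_left h0 hs hst) (neg_fbmPhi_le_right h0 hs hst) hp
    (by positivity)
  rw [two_mul, Real.rpow_add hs, Real.rpow_add hv] at h
  refine abs_le_of_sq_le_sq' ?_ (by positivity) |>.2
  nlinarith [sq_nonneg (s ^ H * (t - s) ^ H)]

lemma abs_eta12_le {H s t : ℝ} (h0 : 0 < H) (h1 : H < 1/2) (hs : 0 < s) (hst : s < t) :
    |eta12 H s t| ≤ 1 / (t - s) + -fbmPhi H s t / (s * (t - s) ^ (2*H)) := by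
  have hv := sub_pos.2 hst
  have hA := Real.rpow_pos_of_pos hs (2*H)
  have hV := Real.rpow_pos_of_pos hv (2*H)
  have hp := neg_nonneg.2 (fbmPhi_nonpos h0 h1 hs hst)
  have hΘ := le_fbmTheta h0 h1 hs hst
  have hΘ₀ := fbmTheta_pos h0 h1 hs hst
  have hnum : s ^ (2*H) * (t - s) ^ (2*H - 1) - s ^ (2*H - 1) * fbmPhi H s t
      = s ^ (2*H) * (t - s) ^ (2*H)
        * (1 / (t - s) + -fbmPhi H s t / (s * (t - s) ^ (2*H))) := by
    rw [Real.rpow_sub_one hs.ne', Real.rpow_sub_one hv.ne']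
    field_simp
    ring
  have hX : 0 ≤ 1 / (t - s) + -fbmPhi H s t / (s * (t - s) ^ (2*H)) := by positivity
  rw [eta12, hnum, abs_of_nonneg (by positivity), div_le_iff₀ hΘ₀]
  generalize 1 / (t - s) + -fbmPhi H s t / (s * (t - s) ^ (2*H)) = X at hX ⊢
  calc H * (s ^ (2*H) * (t - s) ^ (2*H) * X)
      ≤ 1 / 2 * (s ^ (2*H) * (t - s) ^ (2*H) * X) := by gcongr
    _ = X * (s ^ (2*H) * (t - s) ^ (2*H) / 2) := by ring
    _ ≤ X * fbmTheta H s t := by gcongr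

lemma abs_eta22_le {H s t : ℝ} (h0 : 0 < H) (h1 : H < 1/2) (hs : 0 < s) (hst : s < t) :
    |eta22 H s t| ≤ 1 / (t - s) := by
  have hv := sub_pos.2 hst
  have hA := Real.rpow_pos_of_pos hs (2*H)
  have hV := Real.rpow_pos_of_pos hv (2*H)
  have hp := neg_nonneg.2 (fbmPhi_nonpos h0 h1 hs hst)
  have hΘ := le_fbmTheta h0 h1 hs hst
  have hΘ₀ := fbmTheta_pos h0 h1 hs hst
  have ht₁ : t ^ (2*H - 1) ≤ (t - s) ^ (2*H - 1) :=
    Real.rpow_le_rpow_of_nonpos hv (by linarith) (by linarith)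
  have ht₀ : 0 < t ^ (2*H - 1) := Real.rpow_pos_of_pos (hs.trans hst) _
  have hq := mul_le_mul (neg_fbmPhi_le_left h0 hs hst)
    (by linarith : (t - s) ^ (2*H - 1) - t ^ (2*H - 1) ≤ (t - s) ^ (2*H - 1))
    (by linarith) (by positivity)
  have hq₀ := mul_nonneg hp (sub_nonneg.2 ht₁)
  have hnn : 0 < s ^ (2*H) * (t - s) ^ (2*H - 1) := mul_pos hA (Real.rpow_pos_of_pos hv _)
  have hN₀ : 0 ≤ s ^ (2*H) * (t - s) ^ (2*H - 1)
      - fbmPhi H s t * (t ^ (2*H - 1) - (t - s) ^ (2*H - 1)) := by nlinarith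
  have hN₁ : s ^ (2*H) * (t - s) ^ (2*H - 1)
      - fbmPhi H s t * (t ^ (2*H - 1) - (t - s) ^ (2*H - 1))
      ≤ s ^ (2*H) * (t - s) ^ (2*H - 1) := by nlinarith
  rw [eta22, abs_of_nonneg (by positivity), div_le_iff₀ hΘ₀]
  calc H * (s ^ (2*H) * (t - s) ^ (2*H - 1)
        - fbmPhi H s t * (t ^ (2*H - 1) - (t - s) ^ (2*H - 1)))
      ≤ 1 / 2 * (s ^ (2*H) * (t - s) ^ (2*H - 1)) := by gcongr
    _ = 1 / (t - s) * (s ^ (2*H) * (t - s) ^ (2*H) / 2) := by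
        rw [Real.rpow_sub_one hv.ne']; ring
    _ ≤ 1 / (t - s) * fbmTheta H s t := by gcongr

theorem eta12_eta22_bound (H T : ℝ) (h0 : 0 < H) (h1 : H < 1/2) (hT : 0 < T) :
    ∃ C > 0, ∀ s t : ℝ, 0 < s → s < t → t ≤ T →
      |eta12 H s t * eta22 H s t| * (t - s) ^ (2*H)
        ≤ C * ((t - s) ^ (2*H - 2) + s ^ (H - 1) * (t - s) ^ (H - 1)
          + (t - s) ^ (2*H - 1) / t) := by
  refine ⟨1, one_pos, fun s t hs hst _ => ?_⟩
  have hv := sub_pos.2 hst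
  have ht := hs.trans hst
  have hV := Real.rpow_pos_of_pos hv (2*H)
  have hp := neg_nonneg.2 (fbmPhi_nonpos h0 h1 hs hst)
  have hrest : 0 ≤ (t - s) ^ (2*H - 1) / t := by positivity
  have hpow : (t - s) ^ (2*H - 2) = (t - s) ^ (2*H) / (t - s) ^ 2 := by
    exact_mod_cast Real.rpow_sub_natCast hv.ne' (2*H) 2
  calc |eta12 H s t * eta22 H s t| * (t - s) ^ (2*H)
      ≤ (1 / (t - s) + -fbmPhi H s t / (s * (t - s) ^ (2*H))) * (1 / (t - s))
          * (t - s) ^ (2*H) := by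
        rw [abs_mul]
        gcongr
        · exact abs_eta12_le h0 h1 hs hst
        · exact abs_eta22_le h0 h1 hs hst
    _ = (t - s) ^ (2*H - 2) + -fbmPhi H s t / (s * (t - s)) := by
        rw [hpow]
        field_simp
    _ ≤ (t - s) ^ (2*H - 2) + s ^ H * (t - s) ^ H / (s * (t - s)) := by
        gcongr
        exact neg_fbmPhi_le_geom_mean h0 h1 hs hst
    _ = (t - s) ^ (2*H - 2) + s ^ (H - 1) * (t - s) ^ (H - 1) := by
        rw [Real.rpow_sub_one hs.ne', Real.rpow_sub_one hv.ne', mul_div_mul_comm]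
    _ ≤ 1 * ((t - s) ^ (2*H - 2) + s ^ (H - 1) * (t - s) ^ (H - 1)
          + (t - s) ^ (2*H - 1) / t) := by linarith
end

section
/- Let 0 < H < 1/2 and s > 0. Then, as δ tends to 0 from the right, (1/(2δ))·∫_0^s ( R(t+δ, t) − R(max(t−δ, 0), t) ) dt converges to s^{2H}/2. -/
open Real Filter MeasureTheory

theorem fbmR_add_self {H t δ : ℝ} (hδ : 0 ≤ δ) :
    fbmR H (t + δ) t = (t ^ (2*H) + (t + δ) ^ (2*H) - δ ^ (2*H)) / 2 := by
  simp [fbmR, abs_of_nonneg hδ]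

theorem fbmR_sub_self {H t δ : ℝ} (hδ : 0 ≤ δ) :
    fbmR H (t - δ) t = (t ^ (2*H) + (t - δ) ^ (2*H) - δ ^ (2*H)) / 2 := by
  simp [fbmR, abs_of_nonneg hδ]

theorem fbmR_zero_left {H t : ℝ} (hH : 0 < H) (ht : 0 ≤ t) : fbmR H 0 t = 0 := by
  simp [fbmR, abs_of_nonneg ht, hH.ne']

theorem continuous_fbmR_increment {H : ℝ} (hH : 0 < H) (δ : ℝ) :
    Continuous fun t : ℝ => fbmR H (t + δ) t - fbmR H (max (t - δ) 0) t := by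
  have hp : (0 : ℝ) ≤ 2 * H := by positivity
  unfold fbmR
  fun_prop (disch := intros; exact Or.inr hp)

/-- Closed form of the integrated increment of the covariance for small `δ`. -/
theorem setIntegral_fbmR_increment {H s δ : ℝ} (hH : 0 < H) (hδ : 0 < δ) (hδs : δ < s) :
    ∫ t in Set.Ioo (0:ℝ) s, (fbmR H (t + δ) t - fbmR H (max (t - δ) 0) t) =
      (((s + δ) ^ (2*H + 1) - (s - δ) ^ (2*H + 1)) / (2*H + 1) - δ ^ (2*H + 1)) / 2 := by
  have hp : (-1 : ℝ) < 2 * H := by linarith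
  have hp0 : (0 : ℝ) ≤ 2 * H := by linarith
  have hc : Continuous fun t : ℝ => t ^ (2*H) := continuous_rpow_const hp0
  have hcadd : Continuous fun t : ℝ => (t + δ) ^ (2*H) := hc.comp (continuous_add_const δ)
  have hcsub : Continuous fun t : ℝ => (t - δ) ^ (2*H) := hc.comp (continuous_id.sub continuous_const)
  have hsum : Continuous fun t : ℝ => t ^ (2*H) + (t + δ) ^ (2*H) := hc.add hcadd
  have hf := continuous_fbmR_increment hH δ
  have hleft : ∫ t in (0:ℝ)..δ, (fbmR H (t + δ) t - fbmR H (max (t - δ) 0) t) =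
      ∫ t in (0:ℝ)..δ, (t ^ (2*H) + (t + δ) ^ (2*H) - δ ^ (2*H)) / 2 := by
    refine intervalIntegral.integral_congr fun t ht => ?_
    rw [Set.uIcc_of_le hδ.le] at ht
    simp only [max_eq_right (sub_nonpos.2 ht.2), fbmR_zero_left hH ht.1,
      fbmR_add_self hδ.le, sub_zero]
  have hright : ∫ t in δ..s, (fbmR H (t + δ) t - fbmR H (max (t - δ) 0) t) =
      ∫ t in δ..s, ((t + δ) ^ (2*H) - (t - δ) ^ (2*H)) / 2 := by
    refine intervalIntegral.integral_congr fun t ht => ?_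
    rw [Set.uIcc_of_le hδs.le] at ht
    simp only [max_eq_left (sub_nonneg.2 ht.1), fbmR_sub_self hδ.le, fbmR_add_self hδ.le]
    ring
  rw [← integral_Ioc_eq_integral_Ioo, ← intervalIntegral.integral_of_le (hδ.trans hδs).le,
    ← intervalIntegral.integral_add_adjacent_intervals (hf.intervalIntegrable 0 δ)
      (hf.intervalIntegrable δ s), hleft, hright, intervalIntegral.integral_div,
    intervalIntegral.integral_div, intervalIntegral.integral_sub
      (hsum.intervalIntegrable _ _) intervalIntegrable_const,
    intervalIntegral.integral_add (hc.intervalIntegrable _ _) (hcadd.intervalIntegrable _ _),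
    intervalIntegral.integral_sub (hcadd.intervalIntegrable _ _) (hcsub.intervalIntegrable _ _),
    intervalIntegral.integral_comp_add_right (fun t : ℝ => t ^ (2*H)),
    intervalIntegral.integral_comp_add_right (fun t : ℝ => t ^ (2*H)),
    intervalIntegral.integral_comp_sub_right (fun t : ℝ => t ^ (2*H)),
    integral_rpow (Or.inl hp), integral_rpow (Or.inl hp), integral_rpow (Or.inl hp),
    integral_rpow (Or.inl hp), intervalIntegral.integral_const, sub_self, zero_add,
    zero_rpow (by linarith), rpow_add_one hδ.ne']
  simp only [smul_eq_mul]
  field_simp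
  ring

/-- The symmetric difference quotient of `x ↦ x ^ q / q` tends to twice its derivative. -/
theorem tendsto_symmetric_slope_rpow {p s : ℝ} (hp : 0 < p) (hs : 0 < s) :
    Tendsto (fun δ : ℝ => δ⁻¹ * (((s + δ) ^ (p + 1) - (s - δ) ^ (p + 1)) / (p + 1)))
      (nhdsWithin 0 (Set.Ioi 0)) (nhds (2 * s ^ p)) := by
  have hadd : HasDerivAt (fun δ : ℝ => (s + δ) ^ (p + 1)) (1 * (p + 1) * (s + 0) ^ (p + 1 - 1)) 0 :=
    ((hasDerivAt_id (0:ℝ)).const_add s).rpow_const (Or.inr (by linarith))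
  have hsub : HasDerivAt (fun δ : ℝ => (s - δ) ^ (p + 1))
      (-1 * (p + 1) * (s - 0) ^ (p + 1 - 1)) 0 :=
    ((hasDerivAt_id (0:ℝ)).const_sub s).rpow_const (Or.inr (by linarith))
  have h := ((hadd.sub hsub).div_const (p + 1)).tendsto_slope_zero_right
  have hp1 : p + 1 ≠ 0 := by linarith
  convert h using 1
  · ext δ
    simp
  · congr 1
    simp only [add_zero, sub_zero, add_sub_cancel_right]
    field_simp
    ring

theorem averaged_covariance_tendsto (H s : ℝ) (h0 : 0 < H) (h1 : H < 1/2) (hs : 0 < s) :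
    Tendsto
      (fun δ : ℝ =>
        (1 / (2*δ)) * ∫ t in Set.Ioo (0:ℝ) s, (fbmR H (t + δ) t - fbmR H (max (t - δ) 0) t))
      (nhdsWithin 0 (Set.Ioi 0)) (nhds (s ^ (2*H) / 2)) := by
  have hp : 0 < 2 * H := by positivity
  have hpow : Tendsto (fun δ : ℝ => δ ^ (2*H)) (nhdsWithin 0 (Set.Ioi 0)) (nhds 0) := by
    have h := (continuous_rpow_const hp.le).tendsto (0:ℝ)
    rw [zero_rpow hp.ne'] at h
    exact h.mono_left nhdsWithin_le_nhds
  have hlim := ((tendsto_symmetric_slope_rpow hp hs).sub hpow).div_const 4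
  rw [show (2 * s ^ (2*H) - 0) / 4 = s ^ (2*H) / 2 by ring] at hlim
  refine hlim.congr' ?_
  filter_upwards [Ioo_mem_nhdsGT hs] with δ hδ
  rw [setIntegral_fbmR_increment h0 hδ.1 hδ.2, rpow_add_one hδ.1.ne']
  have := hδ.1.ne'
  field_simp
  ring
end
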